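/- Let υ₁, υ₂ > 0 with υ₁ + υ₂ = 1 and υ₁ + 3υ₂ > 1. Let α₀, γ₀ > 0 and define α_k = α₀(1+k)^{−υ₁}, γ_k = γ₀(1+k)^{−υ₂}. Let c₁, c₂, c₃, L, δ₀ > 0 and let u : ℕ → ℝ with u k ≥ 0 satisfy, for every K ≥ 0, ∑_{k=0}^{K} α_k γ_k u_k ≤ (2/c₁)δ₀ + c₃² ∑_{k=0}^{K} α_k γ_k³ + (c₂L/c₁) ∑_{k=0}^{K} α_k² γ_k². Then for every K ≥ 0: (∑_{k=0}^{K} α_k γ_k u_k)/(∑_{k=0}^{K} α_k γ_k) ≤ (1/log(K+2)) · (2δ₀/(c₁α₀γ₀) + (υ₁+3υ₂)(c₃γ₀)²/(υ₁+3υ₂−1) + 2(υ₁+υ₂)c₂α₀γ₀L/(c₁(2υ₁+2υ₂−1))). -/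

import Mathlib

/-- Telescoping step of the integral comparison for `∑ x ^ (-p)`. -/
lemma rpow_neg_le_sub_div {p x : ℝ} (hp : 1 < p) (hx : 1 < x) :
    x ^ (-p) ≤ ((x - 1) ^ (1 - p) - x ^ (1 - p)) / (p - 1) := by
  have hx0 : 0 < x := by linarith
  have hy : 0 < (x - 1) / x := div_pos (by linarith) hx0
  have bernoulli : 1 + (p - 1) / x ≤ ((x - 1) / x) ^ (1 - p) := by
    rw [Real.rpow_def_of_pos hy]
    have hlog : Real.log ((x - 1) / x) ≤ -(1 / x) := by
      have := Real.log_le_sub_one_of_pos hy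
      rw [sub_div, div_self hx0.ne'] at this ⊢
      linarith
    have hmul := mul_le_mul_of_nonneg_left hlog (by linarith : 0 ≤ p - 1)
    have hexp := Real.add_one_le_exp (Real.log ((x - 1) / x) * (1 - p))
    rw [div_eq_mul_one_div (p - 1) x]
    linarith
  have hxp : x ^ (1 - p) = x * x ^ (-p) := by
    rw [sub_eq_add_neg, Real.rpow_add hx0, Real.rpow_one]
  rw [Real.div_rpow (by linarith) hx0.le, le_div_iff₀ (Real.rpow_pos_of_pos hx0 _), hxp] at bernoulli
  rw [le_div_iff₀ (by linarith), hxp]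
  have : (1 + (p - 1) / x) * (x * x ^ (-p)) = x * x ^ (-p) + x ^ (-p) * (p - 1) := by
    field_simp
  linarith

lemma sum_range_one_add_rpow_neg_le {p : ℝ} (hp : 1 < p) (n : ℕ) :
    ∑ k ∈ Finset.range (n + 1), ((1 : ℝ) + k) ^ (-p) ≤ p / (p - 1) := by
  suffices h : ∑ k ∈ Finset.range (n + 1), ((1 : ℝ) + k) ^ (-p)
      ≤ p / (p - 1) - ((1 : ℝ) + n) ^ (1 - p) / (p - 1) by
    have : 0 ≤ ((1 : ℝ) + n) ^ (1 - p) / (p - 1) :=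
      div_nonneg (by positivity) (by linarith)
    linarith
  induction n with
  | zero =>
    rw [← sub_div, le_div_iff₀ (by linarith)]
    simp
  | succ n ih =>
    rw [Finset.sum_range_succ]
    have := rpow_neg_le_sub_div hp (x := 1 + ((n + 1 : ℕ) : ℝ))
      (by push_cast; linarith [n.cast_nonneg (α := ℝ)])
    rw [show (1 + ((n + 1 : ℕ) : ℝ)) - 1 = 1 + n by push_cast; ring, sub_div] at this
    linarith

lemma log_add_two_le_sum_range_inv (n : ℕ) :
    Real.log ((n : ℝ) + 2) ≤ ∑ k ∈ Finset.range (n + 1), ((1 : ℝ) + k)⁻¹ := by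
  have h := log_add_one_le_harmonic (n + 1)
  simp only [harmonic] at h
  push_cast at h
  convert h using 2
  · ring
  · rw [add_comm]

/-- Convergence rate (Theorem 2, boundary case `υ₁ + υ₂ = 1`): under polynomial step
sizes the weighted average of `u` is bounded by `(1/log(K+2)) * (...)`. -/
theorem stmt_15 (υ₁ υ₂ : ℝ) (h1 : 0 < υ₁) (h2 : 0 < υ₂)
    (h3 : υ₁ + υ₂ = 1) (h4 : 1 < υ₁ + 3 * υ₂)
    (α₀ γ₀ c₁ c₂ c₃ L δ₀ : ℝ) (hα₀ : 0 < α₀) (hγ₀ : 0 < γ₀)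
    (hc₁ : 0 < c₁) (hc₂ : 0 < c₂) (hc₃ : 0 < c₃) (hL : 0 < L) (hδ₀ : 0 < δ₀)
    (α γ : ℕ → ℝ)
    (hα : ∀ k : ℕ, α k = α₀ * ((1 : ℝ) + k) ^ (-υ₁))
    (hγ : ∀ k : ℕ, γ k = γ₀ * ((1 : ℝ) + k) ^ (-υ₂))
    (u : ℕ → ℝ) (hu : ∀ k, 0 ≤ u k)
    (hineq : ∀ K : ℕ,
      ∑ k ∈ Finset.range (K + 1), α k * γ k * u k
        ≤ 2 / c₁ * δ₀ + c₃ ^ 2 * ∑ k ∈ Finset.range (K + 1), α k * (γ k) ^ 3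
          + c₂ * L / c₁ * ∑ k ∈ Finset.range (K + 1), (α k) ^ 2 * (γ k) ^ 2) :
    ∀ K : ℕ,
      (∑ k ∈ Finset.range (K + 1), α k * γ k * u k)
          / (∑ k ∈ Finset.range (K + 1), α k * γ k)
        ≤ 1 / Real.log ((K : ℝ) + 2)
          * (2 * δ₀ / (c₁ * α₀ * γ₀)
            + (υ₁ + 3 * υ₂) * (c₃ * γ₀) ^ 2 / (υ₁ + 3 * υ₂ - 1)
            + 2 * (υ₁ + υ₂) * c₂ * α₀ * γ₀ * L / (c₁ * (2 * υ₁ + 2 * υ₂ - 1))) := by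
  intro K
  have hpos (k : ℕ) : (0 : ℝ) < 1 + k := by positivity
  have hαγ (k : ℕ) : α k * γ k = α₀ * γ₀ * ((1 : ℝ) + k)⁻¹ := by
    rw [hα, hγ, mul_mul_mul_comm, ← Real.rpow_add (hpos k), ← neg_add, h3, Real.rpow_neg_one]
  have hαγ3 (k : ℕ) : α k * (γ k) ^ 3 = α₀ * γ₀ ^ 3 * ((1 : ℝ) + k) ^ (-(υ₁ + 3 * υ₂)) := by
    rw [hα, hγ, mul_pow, mul_mul_mul_comm, ← Real.rpow_mul_natCast (hpos k).le,
      ← Real.rpow_add (hpos k)]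
    congr 2
    push_cast
    ring
  have hα2γ2 (k : ℕ) : (α k) ^ 2 * (γ k) ^ 2
      = α₀ ^ 2 * γ₀ ^ 2 * ((1 : ℝ) + k) ^ (-(2 : ℝ)) := by
    rw [← mul_pow, hαγ, Real.rpow_neg (hpos k).le, Real.rpow_two, mul_pow, mul_pow, inv_pow]
  have hlog : 0 < Real.log ((K : ℝ) + 2) :=
    Real.log_pos (by linarith [K.cast_nonneg (α := ℝ)])
  have hden : α₀ * γ₀ * Real.log ((K : ℝ) + 2) ≤ ∑ k ∈ Finset.range (K + 1), α k * γ k := by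
    simp only [hαγ, ← Finset.mul_sum]
    gcongr
    exact log_add_two_le_sum_range_inv K
  have hnum := hineq K
  simp only [hαγ3, hα2γ2, ← Finset.mul_sum] at hnum
  have hbound : ∑ k ∈ Finset.range (K + 1), α k * γ k * u k
      ≤ 2 / c₁ * δ₀ + c₃ ^ 2 * (α₀ * γ₀ ^ 3 * ((υ₁ + 3 * υ₂) / (υ₁ + 3 * υ₂ - 1)))
        + c₂ * L / c₁ * (α₀ ^ 2 * γ₀ ^ 2 * (2 / (2 - 1))) := by
    refine hnum.trans ?_
    gcongr
    · exact sum_range_one_add_rpow_neg_le h4 K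
    · exact sum_range_one_add_rpow_neg_le one_lt_two K
  have hp : 0 < υ₁ + 3 * υ₂ - 1 := by linarith
  have hnonneg : 0 ≤ ∑ k ∈ Finset.range (K + 1), α k * γ k * u k :=
    Finset.sum_nonneg fun k _ => mul_nonneg (by rw [hαγ]; positivity) (hu k)
  calc _ ≤ (∑ k ∈ Finset.range (K + 1), α k * γ k * u k)
        / (α₀ * γ₀ * Real.log ((K : ℝ) + 2)) := by gcongr
    _ ≤ _ := div_le_div_of_nonneg_right hbound (by positivity)
    _ = _ := by
      have hq : 2 * υ₁ + 2 * υ₂ - 1 = 1 := by linarith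
      rw [hq, h3]
      field_simp
      ring
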